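/- Fix a natural number p with p ≥ 3 (cast to ℝ), real numbers ε, ε̃ with ε̃ < ε, and real numbers μ, μ̃, and let Σ, Z be as in the context. Then, along both Filter.atTop and Filter.atBot, 4·((p+1)(3p−2))²·(2·(deriv Z)(K) − Σ(K))·((deriv Z)(K) − Σ(K))/K⁴ tends to −(p−1)²(p−2)(p²+5p−2)(3p²−p+2). -/

import Mathlib

noncomputable def omegaF (p ε : ℝ) (K : ℝ) : ℝ := (p - 1) * K + ε

noncomputable def ThetaF (p ε μ : ℝ) (K : ℝ) : ℝ :=
  2 * K + p * ε - μ * |omegaF p ε K| ^ ((2 : ℝ) / (1 - p))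

noncomputable def SigmaF (p ε ε' μ μ' : ℝ) (K : ℝ) : ℝ :=
  ((omegaF p ε' K) ^ 2 * ThetaF p ε' μ' K - (omegaF p ε K) ^ 2 * ThetaF p ε μ K) /
    (2 * (p + 1) * (ε - ε'))

noncomputable def ZF (p ε ε' μ μ' : ℝ) (K : ℝ) : ℝ :=
  (omegaF p ε K) * (omegaF p ε' K) *
      ((omegaF p ε' K) * ThetaF p ε' μ' K - (omegaF p ε K) * ThetaF p ε μ K) /
    (2 * (p + 1) * (3 * p - 2) * (ε - ε'))

open Filter Topology

lemma hasDerivAt_mul_abs_rpow (s : ℝ) {x : ℝ} (hx : x ≠ 0) :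
    HasDerivAt (fun y : ℝ => y * |y| ^ s) ((1 + s) * |x| ^ s) x := by
  have hlog : HasDerivAt (fun y : ℝ => y * Real.exp (Real.log y * s))
      (1 * Real.exp (Real.log x * s) +
        x * (Real.exp (Real.log x * s) * (x⁻¹ * s))) x :=
    (hasDerivAt_id x).mul (((Real.hasDerivAt_log hx).mul_const s).exp)
  have hrpow : ∀ y : ℝ, y ≠ 0 → |y| ^ s = Real.exp (Real.log y * s) := fun y hy => by
    rw [Real.rpow_def_of_pos (abs_pos.2 hy), Real.log_abs]
  have heq : (fun y : ℝ => y * |y| ^ s) =ᶠ[𝓝 x] fun y => y * Real.exp (Real.log y * s) := by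
    filter_upwards [isOpen_ne.mem_nhds hx] with y hy
    rw [hrpow y hy]
  refine (hlog.congr_of_eventuallyEq heq).congr_deriv ?_
  rw [hrpow x hx]
  field_simp

lemma hasDerivAt_omegaF (p ε K : ℝ) : HasDerivAt (omegaF p ε) (p - 1) K :=
  (((hasDerivAt_id K).const_mul (p - 1)).add_const ε).congr_deriv (mul_one _)

lemma hasDerivAt_omegaF_mul_ThetaF (p ε μ : ℝ) {K : ℝ} (hK : omegaF p ε K ≠ 0) :
    HasDerivAt (fun K => omegaF p ε K * ThetaF p ε μ K)
      ((p - 1) * (2 * K + p * ε) + omegaF p ε K * 2 -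
        μ * ((1 + 2 / (1 - p)) * |omegaF p ε K| ^ (2 / (1 - p)) * (p - 1))) K := by
  have hω := hasDerivAt_omegaF p ε K
  have hlin : HasDerivAt (fun K : ℝ => 2 * K + p * ε) 2 K := by
    simpa using ((hasDerivAt_id K).const_mul 2).add_const (p * ε)
  have hpow := ((hasDerivAt_mul_abs_rpow (2 / (1 - p)) hK).comp K hω).const_mul μ
  refine ((hω.mul hlin).sub hpow).congr_of_eventuallyEq (.of_forall fun y => ?_)
  simp only [ThetaF, Pi.sub_apply, Pi.mul_apply, Function.comp_apply]
  ring

lemma deriv_ZF (p ε ε' μ μ' : ℝ) {K : ℝ} (hK : omegaF p ε K ≠ 0) (hK' : omegaF p ε' K ≠ 0) :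
    deriv (ZF p ε ε' μ μ') K =
      (((p - 1) * omegaF p ε' K + omegaF p ε K * (p - 1)) *
          (omegaF p ε' K * ThetaF p ε' μ' K - omegaF p ε K * ThetaF p ε μ K) +
        omegaF p ε K * omegaF p ε' K *
          (((p - 1) * (2 * K + p * ε') + omegaF p ε' K * 2 -
              μ' * ((1 + 2 / (1 - p)) * |omegaF p ε' K| ^ (2 / (1 - p)) * (p - 1))) -
            ((p - 1) * (2 * K + p * ε) + omegaF p ε K * 2 -
              μ * ((1 + 2 / (1 - p)) * |omegaF p ε K| ^ (2 / (1 - p)) * (p - 1))))) /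
        (2 * (p + 1) * (3 * p - 2) * (ε - ε')) :=
  ((((hasDerivAt_omegaF p ε K).mul (hasDerivAt_omegaF p ε' K)).mul
    ((hasDerivAt_omegaF_mul_ThetaF p ε' μ' hK').sub
      (hasDerivAt_omegaF_mul_ThetaF p ε μ hK))).div_const _).deriv

section Limits

variable {l : Filter ℝ} {p : ℝ}

lemma tendsto_abs_omegaF (hl : Tendsto (fun K : ℝ => |K|) l atTop) (hp : 1 < p) (ε : ℝ) :
    Tendsto (fun K => |omegaF p ε K|) l atTop := by
  refine tendsto_atTop_mono (fun K => ?_)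
    (tendsto_atTop_add_const_right l (-|ε|) (hl.const_mul_atTop (sub_pos.2 hp)))
  have h := abs_sub_abs_le_abs_sub ((p - 1) * K) (-ε)
  rw [abs_mul, abs_of_pos (sub_pos.2 hp), abs_neg, sub_neg_eq_add] at h
  simpa [omegaF, sub_eq_add_neg] using h

lemma eventually_omegaF_ne_zero (hl : Tendsto (fun K : ℝ => |K|) l atTop) (hp : 1 < p) (ε : ℝ) :
    ∀ᶠ K in l, omegaF p ε K ≠ 0 := by
  filter_upwards [(tendsto_abs_omegaF hl hp ε).eventually_gt_atTop 0] with K hK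
  exact abs_pos.1 hK

lemma tendsto_abs_omegaF_rpow (hl : Tendsto (fun K : ℝ => |K|) l atTop) (hp : 1 < p) (ε : ℝ) :
    Tendsto (fun K => |omegaF p ε K| ^ (2 / (1 - p))) l (𝓝 0) := by
  have h := (tendsto_rpow_neg_atTop (y := 2 / (p - 1)) (div_pos two_pos (sub_pos.2 hp))).comp
    (tendsto_abs_omegaF hl hp ε)
  rwa [← div_neg, neg_sub] at h

/-- A continuous function of `K⁻¹` and of the decaying powers tends to its value at the origin. -/
lemma tendsto_of_continuous_inv_rpow (hl : Tendsto (fun K : ℝ => |K|) l atTop) (hp : 1 < p)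
    (ε ε' : ℝ) {Φ : ℝ × ℝ × ℝ → ℝ} (hΦ : Continuous Φ) :
    Tendsto (fun K => Φ (K⁻¹, |omegaF p ε K| ^ (2 / (1 - p)), |omegaF p ε' K| ^ (2 / (1 - p)))) l
      (𝓝 (Φ (0, 0, 0))) := by
  have hinv : Tendsto (fun K : ℝ => K⁻¹) l (𝓝 0) := by
    rw [tendsto_zero_iff_abs_tendsto_zero]
    simpa [Function.comp_def, abs_inv] using tendsto_inv_atTop_zero.comp hl
  exact (hΦ.tendsto _).comp (hinv.prodMk_nhds
    ((tendsto_abs_omegaF_rpow hl hp ε).prodMk_nhds (tendsto_abs_omegaF_rpow hl hp ε')))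

lemma tendsto_SigmaF_div_sq (hl : Tendsto (fun K : ℝ => |K|) l atTop) (hp : 1 < p)
    {ε ε' : ℝ} (hε : ε' < ε) (μ μ' : ℝ) :
    Tendsto (fun K => SigmaF p ε ε' μ μ' K / K ^ 2) l
      (𝓝 (-((p - 1) * (p ^ 2 - p + 4)) / (2 * (p + 1)))) := by
  have hd : ε - ε' ≠ 0 := (sub_pos.2 hε).ne'
  have hp1 : p + 1 ≠ 0 := by linarith
  have h := tendsto_of_continuous_inv_rpow hl hp ε ε'
    (Φ := fun x => (-(p - 1) * (p ^ 2 - p + 4) * (ε - ε') -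
      (ε - ε') * (ε + ε') * (2 + 2 * p * (p - 1)) * x.1 -
      p * (ε ^ 3 - ε' ^ 3) * x.1 ^ 2 +
      μ * (p - 1 + ε * x.1) ^ 2 * x.2.1 - μ' * (p - 1 + ε' * x.1) ^ 2 * x.2.2) /
      (2 * (p + 1) * (ε - ε'))) (by fun_prop)
  refine (h.congr' ?_).trans_eq ?_
  · filter_upwards [hl.eventually_gt_atTop 0] with K hK
    have hK := abs_pos.1 hK
    simp only [SigmaF, ThetaF]
    generalize |omegaF p ε K| ^ (2 / (1 - p)) = r
    generalize |omegaF p ε' K| ^ (2 / (1 - p)) = r'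
    simp only [omegaF]
    field_simp
    ring
  · congr 1
    simp only [mul_zero, add_zero, sub_zero, ne_eq, OfNat.ofNat_ne_zero, not_false_eq_true,
      zero_pow]
    field_simp

lemma tendsto_deriv_ZF_div_sq (hl : Tendsto (fun K : ℝ => |K|) l atTop) (hp : 1 < p)
    {ε ε' : ℝ} (hε : ε' < ε) (μ μ' : ℝ) :
    Tendsto (fun K => deriv (ZF p ε ε' μ μ') K / K ^ 2) l
      (𝓝 (-(3 * (p - 1) ^ 2 * (p ^ 2 - p + 2)) / (2 * (p + 1) * (3 * p - 2)))) := by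
  have hd : ε - ε' ≠ 0 := (sub_pos.2 hε).ne'
  have hp1 : p + 1 ≠ 0 := by linarith
  have hp2 : 3 * p - 2 ≠ 0 := by linarith
  have h := tendsto_of_continuous_inv_rpow hl hp ε ε'
    (Φ := fun x => ((p - 1) * (2 * (p - 1) + (ε + ε') * x.1) *
      (-(ε - ε') * (p ^ 2 - p + 2) - p * (ε - ε') * (ε + ε') * x.1 +
        μ * (p - 1 + ε * x.1) * x.2.1 - μ' * (p - 1 + ε' * x.1) * x.2.2) +
      (p - 1 + ε * x.1) * (p - 1 + ε' * x.1) *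
        (-(ε - ε') * (p ^ 2 - p + 2) +
          (1 + 2 / (1 - p)) * (p - 1) * (μ * x.2.1 - μ' * x.2.2))) /
      (2 * (p + 1) * (3 * p - 2) * (ε - ε'))) (by fun_prop)
  refine (h.congr' ?_).trans_eq ?_
  · filter_upwards [hl.eventually_gt_atTop 0, eventually_omegaF_ne_zero hl hp ε,
      eventually_omegaF_ne_zero hl hp ε'] with K hK hω hω'
    have hK := abs_pos.1 hK
    rw [deriv_ZF p ε ε' μ μ' hω hω']
    simp only [ThetaF]
    generalize |omegaF p ε K| ^ (2 / (1 - p)) = r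
    generalize |omegaF p ε' K| ^ (2 / (1 - p)) = r'
    generalize 2 / (1 - p) = s
    simp only [omegaF]
    field_simp
    ring
  · congr 1
    simp only [mul_zero, add_zero, sub_zero]
    field_simp
    ring

lemma tendsto_deriv_ZF_SigmaF (hl : Tendsto (fun K : ℝ => |K|) l atTop) (hp : 1 < p)
    {ε ε' : ℝ} (hε : ε' < ε) (μ μ' : ℝ) :
    Tendsto (fun K => 4 * ((p + 1) * (3 * p - 2)) ^ 2 *
        (2 * deriv (ZF p ε ε' μ μ') K - SigmaF p ε ε' μ μ' K) *
        (deriv (ZF p ε ε' μ μ') K - SigmaF p ε ε' μ μ' K) / K ^ 4) l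
      (𝓝 (-((p - 1) ^ 2 * (p - 2) * (p ^ 2 + 5 * p - 2) * (3 * p ^ 2 - p + 2)))) := by
  have hp1 : p + 1 ≠ 0 := by linarith
  have hp2 : 3 * p - 2 ≠ 0 := by linarith
  have hZ := tendsto_deriv_ZF_div_sq hl hp hε μ μ'
  have hS := tendsto_SigmaF_div_sq hl hp hε μ μ'
  refine (((((hZ.const_mul 2).sub hS).const_mul (4 * ((p + 1) * (3 * p - 2)) ^ 2)).mul
    (hZ.sub hS)).congr fun K => ?_).trans_eq ?_
  · ring
  · congr 1
    generalize he : 3 * p - 2 = e at hp2 ⊢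
    field_simp
    rw [← he]
    ring

end Limits

theorem stmt_10 (p : ℕ) (hp : 3 ≤ p) (ε ε' μ μ' : ℝ) (hee : ε' < ε) :
    Filter.Tendsto
        (fun K : ℝ =>
          4 * (((p : ℝ) + 1) * (3 * (p : ℝ) - 2)) ^ 2 *
              (2 * deriv (ZF (p : ℝ) ε ε' μ μ') K - SigmaF (p : ℝ) ε ε' μ μ' K) *
              (deriv (ZF (p : ℝ) ε ε' μ μ') K - SigmaF (p : ℝ) ε ε' μ μ' K) / K ^ 4)
        Filter.atTop
        (nhds (-(((p : ℝ) - 1) ^ 2 * ((p : ℝ) - 2) * ((p : ℝ) ^ 2 + 5 * (p : ℝ) - 2) *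
          (3 * (p : ℝ) ^ 2 - (p : ℝ) + 2)))) ∧
      Filter.Tendsto
        (fun K : ℝ =>
          4 * (((p : ℝ) + 1) * (3 * (p : ℝ) - 2)) ^ 2 *
              (2 * deriv (ZF (p : ℝ) ε ε' μ μ') K - SigmaF (p : ℝ) ε ε' μ μ' K) *
              (deriv (ZF (p : ℝ) ε ε' μ μ') K - SigmaF (p : ℝ) ε ε' μ μ' K) / K ^ 4)
        Filter.atBot
        (nhds (-(((p : ℝ) - 1) ^ 2 * ((p : ℝ) - 2) * ((p : ℝ) ^ 2 + 5 * (p : ℝ) - 2) *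
          (3 * (p : ℝ) ^ 2 - (p : ℝ) + 2)))) := by
  have hp1 : (1 : ℝ) < p := by exact_mod_cast (by lia : 1 < p)
  exact ⟨tendsto_deriv_ZF_SigmaF tendsto_abs_atTop_atTop hp1 hee μ μ',
    tendsto_deriv_ZF_SigmaF tendsto_abs_atBot_atTop hp1 hee μ μ'⟩
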